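/- arXiv:math/0611842 — 3 statements merged into one kernel-verified Lean document; each statement's English description precedes it below -/
import Mathlib

section
/- Let G be a finite simple graph with a maximum matching M, let v be a vertex of G that is not a star vertex relative to M, and let u be any vertex of G with u ≠ v. If G' is the graph obtained from G by adding the edge {u,v}, then ν(G') = ν(G), M is a maximum matching of G', and v is not a star vertex of G' relative to M. -/
open SimpleGraph

/-- `M` is a matching of `G`: a set of edges of `G` that are pairwise vertex-disjoint. -/
def IsMatchingSet {V : Type} (G : SimpleGraph V) (M : Set (Sym2 V)) : Prop :=
  M ⊆ G.edgeSet ∧ M.Pairwise fun e f => ∀ v : V, v ∈ e → v ∉ f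

/-- The matching number `ν(G)`: the maximum size of a matching in `G`. -/
noncomputable def nu {V : Type} (G : SimpleGraph V) : ℕ :=
  sSup {n | ∃ M : Set (Sym2 V), IsMatchingSet G M ∧ M.ncard = n}

/-- `v` is saturated (covered) by the matching `M`. -/
def MSaturates {V : Type} (M : Set (Sym2 V)) (v : V) : Prop := ∃ e ∈ M, v ∈ e

/-- The edges of the walk `p` alternate: the `i`-th edge belongs to `M` iff `i` is odd
(so the walk starts with a non-matching edge). -/
def IsAlternating {V : Type} (M : Set (Sym2 V)) {G : SimpleGraph V} {a b : V}
    (p : G.Walk a b) : Prop :=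
  ∀ (i : ℕ) (h : i < p.edges.length), (p.edges[i]'h ∈ M ↔ Odd i)

/-- A star path of `G` relative to `M`: a path of even length, alternating starting with a
non-matching edge, whose initial vertex is `M`-unsaturated. -/
def IsStarPath {V : Type} (M : Set (Sym2 V)) {G : SimpleGraph V} {a b : V}
    (p : G.Walk a b) : Prop :=
  p.IsPath ∧ Even p.length ∧ ¬ MSaturates M a ∧ IsAlternating M p

/-- `v` is a star vertex of `G` relative to `M`: some star path terminates at `v`. -/
def IsStarVertex {V : Type} (G : SimpleGraph V) (M : Set (Sym2 V)) (v : V) : Prop :=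
  ∃ a : V, ∃ p : G.Walk a v, IsStarPath M p

/-- An `M`-augmenting path: a path of odd length, alternating starting and ending with
non-matching edges, both of whose endpoints are `M`-unsaturated. -/
def IsAugPath {V : Type} (M : Set (Sym2 V)) {G : SimpleGraph V} {a b : V}
    (p : G.Walk a b) : Prop :=
  p.IsPath ∧ Odd p.length ∧ ¬ MSaturates M a ∧ ¬ MSaturates M b ∧ IsAlternating M p

/-- `G ∈ F(d,m)`: `G` is a finite simple graph with maximum degree `< d` and matching
number `< m`, edge-maximal with this property among all finite graphs on vertex sets
containing `V(G)`. -/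
def MemF (d m : ℕ) {V : Type} [Fintype V] (G : SimpleGraph V) : Prop :=
  (∀ v : V, (G.neighborSet v).ncard < d) ∧ nu G < m ∧
  ∀ (W : Type) [Fintype W] (f : V ↪ W) (G' : SimpleGraph W),
    (∀ u v : V, G.Adj u v → G'.Adj (f u) (f v)) →
    G.edgeSet.ncard < G'.edgeSet.ncard →
    (∃ w : W, d ≤ (G'.neighborSet w).ncard) ∨ m ≤ nu G'

theorem IsMatchingSet.eq_of_mem {V : Type} {G : SimpleGraph V} {M : Set (Sym2 V)}
    (hM : IsMatchingSet G M) {e f : Sym2 V} (he : e ∈ M) (hf : f ∈ M) {v : V}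
    (hve : v ∈ e) (hvf : v ∈ f) : e = f := by
  by_contra h
  exact hM.2 he hf h v hve hvf

theorem IsMatchingSet.subset {V : Type} {G : SimpleGraph V} {M N : Set (Sym2 V)}
    (hM : IsMatchingSet G M) (h : N ⊆ M) : IsMatchingSet G N :=
  ⟨h.trans hM.1, hM.2.mono h⟩

theorem IsMatchingSet.insert {V : Type} {G : SimpleGraph V} {M : Set (Sym2 V)}
    (hM : IsMatchingSet G M) {v w : V} (hvw : G.Adj v w)
    (hv : ¬ MSaturates M v) (hw : ¬ MSaturates M w) :
    IsMatchingSet G (insert s(v, w) M) := by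
  refine ⟨Set.insert_subset hvw hM.1, hM.2.insert fun e he _ => ⟨fun x hx hxe => ?_,
    fun x hxe hx => ?_⟩⟩ <;>
  · rcases Sym2.mem_iff.1 hx with rfl | rfl
    · exact hv ⟨e, he, hxe⟩
    · exact hw ⟨e, he, hxe⟩

theorem IsMatchingSet.not_mSaturates_diff {V : Type} {G : SimpleGraph V} {M : Set (Sym2 V)}
    (hM : IsMatchingSet G M) {e : Sym2 V} (he : e ∈ M) {v : V} (hv : v ∈ e) :
    ¬ MSaturates (M \ {e}) v :=
  fun ⟨_, hf, hvf⟩ => hf.2 (hM.eq_of_mem hf.1 he hvf hv)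

theorem IsMatchingSet.ncard_le_nu {V : Type} [Fintype V] {G : SimpleGraph V} {M : Set (Sym2 V)}
    (hM : IsMatchingSet G M) : M.ncard ≤ nu G := by
  refine le_csSup ⟨Nat.card (Sym2 V), ?_⟩ ⟨M, hM, rfl⟩
  rintro _ ⟨N, -, rfl⟩
  exact Set.ncard_le_card N

theorem IsAlternating.concat {V : Type} {G : SimpleGraph V} {M : Set (Sym2 V)} {a b c : V}
    {p : G.Walk a b} (hp : IsAlternating M p) (h : G.Adj b c)
    (hM : s(b, c) ∈ M ↔ Odd p.length) : IsAlternating M (p.concat h) := by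
  intro i hi
  simp only [Walk.edges_concat, List.concat_eq_append, List.getElem_append]
  split_ifs with hlt
  · exact hp i hlt
  · have : i = p.length := by
      simp only [Walk.length_edges, Walk.length_concat] at hi hlt
      omega
    subst this
    simpa using hM

/-- A vertex missed by some maximum matching `N` is the end of a star path relative to any matching
`M`, and the path can be chosen so that every other vertex on it is covered by `N \ M`. -/
theorem exists_isStarPath_of_not_mSaturates {V : Type} [Fintype V] {G : SimpleGraph V}
    {M : Set (Sym2 V)} (hM : IsMatchingSet G M) (n : ℕ) :
    ∀ (N : Set (Sym2 V)) (v : V), (N \ M).ncard = n → IsMatchingSet G N → N.ncard = nu G →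
      ¬ MSaturates N v →
      ∃ (a : V) (p : G.Walk a v), IsStarPath M p ∧
        ∀ y ∈ p.support, y ≠ v → MSaturates (N \ M) y := by
  induction n using Nat.strong_induction_on with
  | _ n ih =>
  intro N v hn hN hcard hv
  by_cases hvM : MSaturates M v
  swap
  · refine ⟨v, .nil, ⟨.nil, by simp, hvM, fun i hi => by simp at hi⟩, ?_⟩
    simp
  obtain ⟨e, heM, hve⟩ := hvM
  obtain ⟨w, rfl⟩ := Sym2.mem_iff_exists.1 hve
  have hvw : G.Adj v w := hM.1 heM
  have hvwN : s(v, w) ∉ N := fun h => hv ⟨_, h, hve⟩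
  have hwN : MSaturates N w := by
    by_contra hw
    have := (hN.insert hvw hv hw).ncard_le_nu
    rw [Set.ncard_insert_of_notMem hvwN] at this
    omega
  obtain ⟨f, hfN, hwf⟩ := hwN
  obtain ⟨x, rfl⟩ := Sym2.mem_iff_exists.1 hwf
  have hxw : G.Adj x w := (hN.1 hfN : G.Adj w x).symm
  have hxv : x ≠ v := by
    rintro rfl
    exact hv ⟨_, hfN, by simp⟩
  have hfM : s(w, x) ∉ M := by
    intro h
    have := hM.eq_of_mem h heM (v := w) (by simp) (by simp)
    rw [Sym2.eq_swap, Sym2.congr_left] at this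
    exact hxv this
  have hvD : ¬ MSaturates (N \ {s(w, x)}) v := fun ⟨e, he, h⟩ => hv ⟨e, he.1, h⟩
  have hN' := (hN.subset Set.sdiff_subset).insert hvw hvD (hN.not_mSaturates_diff hfN hwf)
  have hcard' : (insert s(v, w) (N \ {s(w, x)})).ncard = nu G := by
    rw [Set.ncard_insert_of_notMem fun h => hvwN h.1, Set.ncard_sdiff_singleton_add_one hfN, hcard]
  have hdiff : insert s(v, w) (N \ {s(w, x)}) \ M = (N \ {s(w, x)}) \ M :=
    Set.insert_sdiff_of_mem _ heM
  have hlt : ((N \ {s(w, x)}) \ M).ncard < n := by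
    rw [← hn]
    refine Set.ncard_lt_ncard ⟨Set.sdiff_subset_sdiff_left Set.sdiff_subset, fun h => ?_⟩
    exact (h ⟨hfN, hfM⟩).1.2 rfl
  have hx : ¬ MSaturates (insert s(v, w) (N \ {s(w, x)})) x := by
    rintro ⟨e, rfl | he, hxe⟩
    · rcases Sym2.mem_iff.1 hxe with h | h
      · exact hxv h
      · exact hxw.ne h
    · exact hN.not_mSaturates_diff hfN (by simp) ⟨e, he, hxe⟩
  obtain ⟨a, p, ⟨hp, hpe, ha, hpa⟩, hsat⟩ :=
    ih _ hlt _ x (by rw [hdiff]) hN' hcard' hx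
  rw [hdiff] at hsat
  have hwp : w ∉ p.support := fun h => by
    obtain ⟨e, he, hwe⟩ := hsat w h hxw.ne'
    exact hN.not_mSaturates_diff hfN hwf ⟨e, he.1, hwe⟩
  have hvp : v ∉ p.support := fun h => by
    obtain ⟨e, he, hve⟩ := hsat v h hxv.symm
    exact hvD ⟨e, he.1, hve⟩
  have hsw : MSaturates (N \ M) w := ⟨_, ⟨hfN, hfM⟩, hwf⟩
  refine ⟨a, (p.concat hxw).concat hvw.symm, ⟨?_, ?_, ha, ?_⟩, ?_⟩
  · refine (hp.concat hwp hxw).concat ?_ hvw.symm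
    simp [Walk.support_concat, hvp, hvw.ne]
  · simpa [Nat.even_add_one] using hpe
  · refine (hpa.concat hxw ?_).concat hvw.symm ?_
    · rw [Sym2.eq_swap]
      exact iff_of_false hfM (Nat.not_odd_iff_even.2 hpe)
    · rw [Sym2.eq_swap, Walk.length_concat]
      exact iff_of_true heM hpe.add_one
  · intro y hy hyv
    simp only [Walk.support_concat, List.mem_append, List.mem_singleton] at hy
    rcases hy with (hy | rfl) | rfl
    · by_cases hyx : y = x
      · exact ⟨_, ⟨hfN, hfM⟩, by simp [hyx]⟩
      · obtain ⟨e, he, hye⟩ := hsat y hy hyx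
        exact ⟨e, ⟨he.1.1, he.2⟩, hye⟩
    · exact hsw
    · exact absurd rfl hyv

/-- The only edge of a star path that meets its end is its last edge, a matching edge. -/
theorem IsStarPath.mem_of_mem_edges {V : Type} {G : SimpleGraph V} {M : Set (Sym2 V)} {a v : V}
    {p : G.Walk a v} (hp : IsStarPath M p) {e : Sym2 V} (he : e ∈ p.edges) (hv : v ∈ e) :
    e ∈ M := by
  obtain ⟨hpath, heven, -, halt⟩ := hp
  induction p using Walk.concatRec with
  | Hnil => simp at he
  | Hconcat q h _ =>
    rw [Walk.concat_isPath_iff] at hpath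
    rw [Walk.edges_concat, List.concat_eq_append, List.mem_append, List.mem_singleton] at he
    rcases he with he | rfl
    · exact absurd (Walk.mem_support_of_mem_edges he hv) hpath.2
    · have := halt q.length (by simp)
      simp only [Walk.edges_concat, List.concat_eq_append, ← Walk.length_edges,
        List.getElem_concat_length] at this
      rw [Walk.length_concat, Nat.even_add_one, Nat.not_even_iff_odd, ← Walk.length_edges] at heven
      exact this.2 heven

/-- adding an edge at a non-star vertex `v` preserves the matching number,
keeps `M` a maximum matching, and `v` remains a non-star vertex. -/
theorem stmt_2 {V : Type} [Fintype V] (G : SimpleGraph V) (M : Set (Sym2 V))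
    (hM : IsMatchingSet G M) (hmax : M.ncard = nu G) (v u : V)
    (hv : ¬ IsStarVertex G M v) (huv : u ≠ v)
    (G' : SimpleGraph V) (hG' : G' = G ⊔ SimpleGraph.fromEdgeSet {s(u, v)}) :
    nu G' = nu G ∧ (IsMatchingSet G' M ∧ M.ncard = nu G') ∧ ¬ IsStarVertex G' M v := by
  have hedge : ∀ e ∈ G'.edgeSet, e ≠ s(u, v) → e ∈ G.edgeSet := by
    intro e he hne
    rw [hG', edgeSet_sup, edgeSet_fromEdgeSet] at he
    rcases he with he | he
    · exact he
    · exact absurd he.1 hne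
  have hM' : IsMatchingSet G' M := by
    refine ⟨hM.1.trans ?_, hM.2⟩
    rw [hG', edgeSet_sup]
    exact Set.subset_union_left
  have hle : nu G' ≤ nu G := by
    refine csSup_le ⟨_, M, hM', rfl⟩ ?_
    rintro _ ⟨N, hN, rfl⟩
    by_cases huvN : s(u, v) ∈ N
    · have hD : IsMatchingSet G (N \ {s(u, v)}) :=
        ⟨fun e he => hedge e (hN.1 he.1) he.2, hN.2.mono Set.sdiff_subset⟩
      have h1 := Set.ncard_sdiff_singleton_add_one huvN
      have h2 := hD.ncard_le_nu
      by_contra! h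
      obtain ⟨a, p, hp, -⟩ := exists_isStarPath_of_not_mSaturates hM _ _ v rfl hD (by omega)
        (hN.not_mSaturates_diff huvN (by simp))
      exact hv ⟨a, p, hp⟩
    · refine IsMatchingSet.ncard_le_nu ⟨fun e he => hedge e (hN.1 he) ?_, hN.2⟩
      rintro rfl
      exact huvN he
  have hnu : nu G' = nu G := le_antisymm hle (hmax ▸ hM'.ncard_le_nu)
  refine ⟨hnu, ⟨hM', hmax.trans hnu.symm⟩, ?_⟩
  rintro ⟨a, p, hp⟩
  have hpG : ∀ e ∈ p.edges, e ∈ G.edgeSet := by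
    intro e he
    by_cases heq : e = s(u, v)
    · exact hM.1 (hp.mem_of_mem_edges he (by simp [heq]))
    · exact hedge e (p.edges_subset_edgeSet he) heq
  obtain ⟨hpath, heven, ha, halt⟩ := hp
  exact hv ⟨a, p.transfer G hpG, hpath.transfer hpG, by simpa using heven, ha,
    fun i hi => by simpa using halt i (by simpa using hi)⟩
end

section
/- Let G be a finite simple graph and M a maximum matching of G. If C is a connected component of G all of whose vertices are star vertices of G relative to M, then C contains exactly one M-unsaturated vertex. -/
open SimpleGraph

/-- An involution of the vertices moving each vertex to itself or to a neighbour: the partner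
function of a matching, whose fixed points are the unsaturated vertices. -/
def IsPartner {V : Type} (G : SimpleGraph V) (m : V → V) : Prop :=
  Function.Involutive m ∧ ∀ x, m x ≠ x → G.Adj x (m x)

/-- A partner function with the least possible number of fixed points. -/
def IsMaxPartner {V : Type} (G : SimpleGraph V) (m : V → V) : Prop :=
  IsPartner G m ∧ ∀ n, IsPartner G n →
    (Function.fixedPoints m).ncard ≤ (Function.fixedPoints n).ncard

theorem IsMatchingSet.eq_of_mem_s5 {V : Type} {G : SimpleGraph V} {M : Set (Sym2 V)}
    (hM : IsMatchingSet G M) {x y z : V} (hy : s(x, y) ∈ M) (hz : s(x, z) ∈ M) : y = z := by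
  by_contra h
  exact hM.2 hy hz (mt Sym2.congr_right.1 h) x (by simp) (by simp)

theorem IsMatchingSet.exists_isPartner {V : Type} {G : SimpleGraph V} {M : Set (Sym2 V)}
    (hM : IsMatchingSet G M) :
    ∃ m, IsPartner G m ∧ (∀ x y, s(x, y) ∈ M → m x = y) ∧
      Function.fixedPoints m = {x | ¬ MSaturates M x} := by
  classical
  let m : V → V := fun x => if h : ∃ y, s(x, y) ∈ M then h.choose else x
  have hm : ∀ x y, s(x, y) ∈ M → m x = y := fun x y h => by
    have hx : ∃ y, s(x, y) ∈ M := ⟨y, h⟩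
    simp only [m, dif_pos hx]
    exact hM.eq_of_mem_s5 hx.choose_spec h
  have hm' : ∀ x, (¬ ∃ y, s(x, y) ∈ M) → m x = x := fun x h => dif_neg h
  refine ⟨m, ⟨fun x => ?_, fun x hx => ?_⟩, hm, ?_⟩
  · by_cases h : ∃ y, s(x, y) ∈ M
    · obtain ⟨y, hy⟩ := h
      rw [hm x y hy]
      exact hm y x (Sym2.eq_swap ▸ hy)
    · rw [hm' x h, hm' x h]
  · by_cases h : ∃ y, s(x, y) ∈ M
    · obtain ⟨y, hy⟩ := h
      rw [hm x y hy]
      exact hM.1 hy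
    · exact absurd (hm' x h) hx
  · ext x
    simp only [Function.mem_fixedPoints_iff, Set.mem_ofPred_eq]
    constructor
    · rintro h ⟨e, he, hx⟩
      obtain ⟨y, rfl⟩ := Sym2.mem_iff_exists.1 hx
      exact (hM.1 he : G.Adj x y).ne (h.symm.trans (hm x y he))
    · exact fun h => hm' x fun ⟨y, hy⟩ => h ⟨_, hy, by simp⟩

theorem IsPartner.exists_isMatchingSet {V : Type} {G : SimpleGraph V} {m : V → V}
    (hm : IsPartner G m) :
    ∃ M, IsMatchingSet G M ∧ Function.fixedPoints m = {x | ¬ MSaturates M x} := by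
  refine ⟨{e | ∃ x, m x ≠ x ∧ e = s(x, m x)}, ⟨?_, ?_⟩, ?_⟩
  · rintro _ ⟨x, hx, rfl⟩
    exact hm.2 x hx
  · rintro _ ⟨x, hx, rfl⟩ _ ⟨y, hy, rfl⟩ hne v hv hv'
    have := hm.1 x
    have := hm.1 y
    simp only [Sym2.mem_iff] at hv hv'
    apply hne
    rw [Sym2.eq_iff]
    grind
  · ext x
    simp only [Function.mem_fixedPoints_iff, Set.mem_ofPred_eq, MSaturates]
    constructor
    · rintro h ⟨_, ⟨y, hy, rfl⟩, hx⟩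
      have := hm.1 y
      simp only [Sym2.mem_iff] at hx
      grind
    · intro h
      by_contra hx
      exact h ⟨_, ⟨x, hx, rfl⟩, by simp⟩

theorem IsMatchingSet.two_mul_ncard_add {V : Type} [Fintype V] {G : SimpleGraph V}
    {M : Set (Sym2 V)} (hM : IsMatchingSet G M) :
    2 * M.ncard + {x | ¬ MSaturates M x}.ncard = Fintype.card V := by
  classical
  have hsat : {x | MSaturates M x}.ncard = 2 * M.ncard := by
    have h : {x | MSaturates M x} = (M.toFinset.biUnion Sym2.toFinset : Finset V) := by
      ext x
      simp [MSaturates]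
    rw [h, Set.ncard_coe_finset, Finset.card_biUnion, Set.ncard_eq_toFinset_card', mul_comm]
    · refine Finset.sum_const_nat fun e he => ?_
      exact Sym2.card_toFinset_of_not_isDiag e
        (G.not_isDiag_of_mem_edgeSet (hM.1 (by simpa using he)))
    · intro e he f hf hne
      rw [Function.onFun, Finset.disjoint_left]
      intro v hv hv'
      exact hM.2 (by simpa using he) (by simpa using hf) hne v (by simpa using hv)
        (by simpa using hv')
  rw [← hsat, ← Nat.card_eq_fintype_card]
  exact Set.ncard_add_ncard_compl {x | MSaturates M x}

theorem IsMatchingSet.exists_isMaxPartner {V : Type} [Fintype V] {G : SimpleGraph V}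
    {M : Set (Sym2 V)} (hM : IsMatchingSet G M) (hmax : M.ncard = nu G) :
    ∃ m, IsMaxPartner G m ∧ (∀ x y, s(x, y) ∈ M → m x = y) ∧
      Function.fixedPoints m = {x | ¬ MSaturates M x} := by
  obtain ⟨m, hm, hmM, hfix⟩ := hM.exists_isPartner
  refine ⟨m, ⟨hm, fun n hn => ?_⟩, hmM, hfix⟩
  obtain ⟨N, hN, hNfix⟩ := hn.exists_isMatchingSet
  rw [hfix, hNfix]
  have := hM.two_mul_ncard_add
  have := hN.two_mul_ncard_add
  have := hN.ncard_le_nu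
  lia

/-- Exchanging the first two edges of an alternating path. -/
theorem IsMaxPartner.conj_swap {V : Type} [DecidableEq V] {G : SimpleGraph V} {m : V → V}
    (hm : IsMaxPartner G m) {a b c : V} (ha : m a = a) (hb : m b = c) (hab : G.Adj a b) :
    IsMaxPartner G (Equiv.swap a c ∘ m ∘ Equiv.swap a c) := by
  have hc : m c = b := hb ▸ hm.1.1 b
  refine ⟨⟨fun x => ?_, fun x hx => ?_⟩, fun n hn => le_trans (le_of_eq ?_) (hm.2 n hn)⟩
  · simp [hm.1.1 _]
  · have h1 := hm.1.2 x
    have h2 := hm.1.1 x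
    have := hab.symm
    have := hab.ne
    simp only [Function.comp_apply, Equiv.swap_apply_def] at hx ⊢
    grind
  · have h : Function.fixedPoints (Equiv.swap a c ∘ m ∘ Equiv.swap a c) =
        Equiv.swap a c '' Function.fixedPoints m := by
      ext x
      rw [Equiv.image_eq_preimage_symm]
      simp [Function.IsFixedPt, Equiv.swap_apply_eq_iff]
    rw [h, Set.ncard_image_of_injective _ (Equiv.injective _)]

/-- Exchanging along an even alternating path from a fixed point yields a maximum matching
missing the other end of the path. -/
theorem IsMaxPartner.exists_fixed_end {V : Type} {G : SimpleGraph V} (k : ℕ) :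
    ∀ {m : V → V} {a v : V} (p : G.Walk a v), IsMaxPartner G m → m a = a → p.IsPath →
      p.length = 2 * k →
      (∀ i, Odd i → i < p.length → m (p.getVert i) = p.getVert (i + 1)) →
      ∃ m', IsMaxPartner G m' ∧ m' v = v := by
  classical
  induction k with
  | zero =>
    intro m a v p hm ha _ hlen _
    obtain rfl := Walk.eq_of_length_eq_zero (by simpa using hlen)
    exact ⟨m, hm, ha⟩
  | succ k ih =>
    intro m a v p hm ha hp hlen halt
    match p with
    | .nil => simp at hlen
    | .cons _ .nil => simp at hlen; lia
    | .cons (v := b) hab (.cons (v := c) hbc q) =>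
      have hb : m b = c := by simpa using halt 1 odd_one (by simp)
      have hc : m c = b := hb ▸ hm.1.1 b
      simp only [Walk.cons_isPath_iff, Walk.support_cons, List.mem_cons, not_or] at hp
      refine ih q (hm.conj_swap ha hb hab) (by simp [ha]) hp.1.1 (by simp at hlen; lia) ?_
      intro i hi hlt
      have h := halt (i + 2) (by simpa [Nat.odd_add] using hi) (by simpa using hlt)
      simp only [Walk.getVert_cons_succ] at h
      have hia : q.getVert i ≠ a := fun h' => hp.2.2 (h' ▸ q.getVert_mem_support i)
      have hja : q.getVert (i + 1) ≠ a := fun h' => hp.2.2 (h' ▸ q.getVert_mem_support _)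
      have hjb : q.getVert (i + 1) ≠ b := fun h' => hp.1.2 (h' ▸ q.getVert_mem_support _)
      have hic : q.getVert i ≠ c := fun h' => hjb (by rw [← h, h', hc])
      have hjc : q.getVert (i + 1) ≠ c := by
        intro h'
        have : q.getVert i = b := by rw [← hm.1.1 (q.getVert i), h, h', hc]
        exact hp.1.2 (this ▸ q.getVert_mem_support i)
      simp [Equiv.swap_apply_of_ne_of_ne hia hic, h, Equiv.swap_apply_of_ne_of_ne hja hjc]

theorem IsPartner.piecewise {V : Type} {G : SimpleGraph V} {m n : V → V} (hm : IsPartner G m)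
    (hn : IsPartner G n) (S : Set V) [DecidablePred (· ∈ S)] (hmS : ∀ x ∈ S, m x ∈ S)
    (hnS : ∀ x ∈ S, n x ∈ S) : IsPartner G (S.piecewise n m) := by
  have h1 := hm.1
  have h2 := hn.1
  have h3 := hm.2
  have h4 := hn.2
  simp only [Function.Involutive] at h1 h2
  refine ⟨fun x => ?_, fun x => ?_⟩ <;> simp only [Set.piecewise] <;> grind

theorem ncard_fixedPoints_piecewise {V : Type} [Finite V] (m n : V → V) (S : Set V)
    [DecidablePred (· ∈ S)] :
    (Function.fixedPoints (S.piecewise n m)).ncard =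
      (Function.fixedPoints n ∩ S).ncard + (Function.fixedPoints m \ S).ncard := by
  rw [← Set.ncard_inter_add_ncard_sdiff_eq_ncard (Function.fixedPoints (S.piecewise n m)) S]
  congr 2 <;> ext x <;>
    simp only [Set.mem_inter_iff, Set.mem_sdiff, Function.mem_fixedPoints_iff, Set.piecewise] <;>
    grind

/-- Exchanging two maximum matchings on a set closed under both keeps maximality. -/
theorem IsMaxPartner.piecewise {V : Type} [Finite V] {G : SimpleGraph V} {m n : V → V}
    (hm : IsMaxPartner G m) (hn : IsMaxPartner G n) (S : Set V) [DecidablePred (· ∈ S)]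
    (hmS : ∀ x ∈ S, m x ∈ S) (hnS : ∀ x ∈ S, n x ∈ S) :
    IsMaxPartner G (S.piecewise n m) := by
  refine ⟨hm.1.piecewise hn.1 S hmS hnS, fun l hl => le_trans ?_ (hm.2 l hl)⟩
  have h := hn.2 _ (hn.1.piecewise hm.1 S hnS hmS)
  rw [ncard_fixedPoints_piecewise] at h ⊢
  rw [← Set.ncard_inter_add_ncard_sdiff_eq_ncard (Function.fixedPoints n) S] at h
  rw [← Set.ncard_inter_add_ncard_sdiff_eq_ncard (Function.fixedPoints m) S]
  lia

/-- If `n` fixes `t`, the orbit of `t` under two involutions `m`, `n` is closed under both and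
contains at most one fixed point of `m`. -/
theorem exists_invariant_set {V : Type} {m n : V → V} (hm : Function.Involutive m)
    (hn : Function.Involutive n) {t : V} (ht : n t = t) :
    ∃ S : Set V, t ∈ S ∧ (∀ x ∈ S, m x ∈ S) ∧ (∀ x ∈ S, n x ∈ S) ∧
      ∀ u ∈ S, ∀ v ∈ S, m u = u → m v = v → u = v := by
  let f : Equiv.Perm V := hn.toPerm * hm.toPerm
  have hinv : ∀ x, f⁻¹ x = m (n x) := fun x => by
    rw [Equiv.Perm.inv_eq_iff_eq]
    simp [f, hm _, hn _]
  have hconj : hn.toPerm * f * hn.toPerm⁻¹ = f⁻¹ := by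
    ext x
    rw [hinv]
    simp [f, hn _]
  have hnf : ∀ k : ℤ, n ((f ^ k) t) = (f ^ (-k)) t := fun k => by
    have h : hn.toPerm * f ^ k * hn.toPerm⁻¹ = f ^ (-k) := by
      rw [← conj_zpow, hconj, inv_zpow, zpow_neg]
    have ht' : hn.toPerm⁻¹ t = t := by rw [Equiv.Perm.inv_eq_iff_eq]; simp [ht]
    rw [← h, Equiv.Perm.mul_apply, Equiv.Perm.mul_apply, ht']
    rfl
  have hmf : ∀ k : ℤ, m ((f ^ k) t) = (f ^ (-k - 1)) t := fun k => by
    rw [show -k - 1 = -(1 + k) by ring, ← hnf, zpow_add]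
    simp [f, hn _]
  refine ⟨{x | ∃ k : ℤ, x = (f ^ k) t}, ⟨0, by simp⟩, ?_, ?_, ?_⟩
  · rintro _ ⟨k, rfl⟩
    exact ⟨_, hmf k⟩
  · rintro _ ⟨k, rfl⟩
    exact ⟨_, hnf k⟩
  · have hodd : ∀ k : ℤ, m ((f ^ k) t) = (f ^ k) t →
        f ^ (2 * k + 1) ∈ MulAction.stabilizer (Equiv.Perm V) t := fun k hk => by
      rw [hmf] at hk
      rw [MulAction.mem_stabilizer_iff, Equiv.Perm.smul_def,
        show 2 * k + 1 = (k + 1) + k by ring, zpow_add, Equiv.Perm.mul_apply, ← hk,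
        ← Equiv.Perm.mul_apply, ← zpow_add]
      simp
    rintro _ ⟨k, rfl⟩ _ ⟨j, rfl⟩ hk hj
    have h1 := hodd k hk
    have h2 := hodd j hj
    have h3 := mul_mem (zpow_mem h1 (-j)) (zpow_mem h2 k)
    rw [← zpow_mul, ← zpow_mul, ← zpow_add] at h3
    have h4 : f ^ (k - j) ∈ MulAction.stabilizer (Equiv.Perm V) t := by
      convert h3 using 2
      ring
    rw [MulAction.mem_stabilizer_iff, Equiv.Perm.smul_def] at h4
    rw [show k = j + (k - j) by ring, zpow_add, Equiv.Perm.mul_apply, h4]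

/-- No maximum matching misses both of two distinct vertices `u` and `v`. -/
def NotBothMissed {V : Type} (G : SimpleGraph V) (u v : V) : Prop :=
  ∀ m, IsMaxPartner G m → m u = u → m v = v → u = v

theorem NotBothMissed.trans {V : Type} [Finite V] {G : SimpleGraph V} {u t v : V}
    (hut : NotBothMissed G u t) (htv : NotBothMissed G t v)
    (ht : ∃ n, IsMaxPartner G n ∧ n t = t) : NotBothMissed G u v := by
  classical
  intro m hm hu hv
  obtain ⟨n, hn, hnt⟩ := ht
  obtain ⟨S, htS, hmS, hnS, hS⟩ := exists_invariant_set hm.1.1 hn.1.1 hnt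
  have hmax := hm.piecewise hn S hmS hnS
  have htfix : S.piecewise n m t = t := by simp [htS, hnt]
  have huS : u ∈ S := by
    by_contra h
    exact h (hut _ hmax (by simp [h, hu]) htfix ▸ htS)
  have hvS : v ∈ S := by
    by_contra h
    exact h (htv _ hmax htfix (by simp [h, hv]) ▸ htS)
  exact hS u huS v hvS hu hv

theorem SimpleGraph.Adj.notBothMissed {V : Type} [Finite V] {G : SimpleGraph V} {u v : V}
    (h : G.Adj u v) : NotBothMissed G u v := by
  classical
  intro m hm hu hv
  exfalso
  have hS : ∀ x ∈ ({u, v} : Set V), m x ∈ ({u, v} : Set V) := by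
    rintro x (rfl | rfl) <;> simp [hu, hv]
  have hswap : IsPartner G (Equiv.swap u v) := by
    refine ⟨fun x => by simp, fun x hx => ?_⟩
    have := h.symm
    simp only [Equiv.swap_apply_def] at hx ⊢
    grind
  have hp := hm.1.piecewise hswap {u, v} hS (by rintro x (rfl | rfl) <;> simp)
  refine (hm.2 _ hp).not_gt (Set.ncard_lt_ncard ⟨fun x hx => ?_, fun hsub => ?_⟩)
  · have := h.ne
    simp only [Function.mem_fixedPoints_iff, Set.piecewise, Equiv.swap_apply_def] at hx ⊢
    grind
  · have := hsub (show u ∈ Function.fixedPoints m from hu)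
    simp [Function.IsFixedPt, h.ne'] at this

/-- Gallai's lemma along a walk. -/
theorem SimpleGraph.Walk.notBothMissed {V : Type} [Finite V] {G : SimpleGraph V} {u v : V}
    (p : G.Walk u v) (hp : ∀ x ∈ p.support, ∃ m, IsMaxPartner G m ∧ m x = x) :
    NotBothMissed G u v := by
  induction p with
  | nil => exact fun _ _ _ _ => rfl
  | cons h p ih =>
    exact h.notBothMissed.trans (ih fun x hx => hp x (by simp [hx])) (hp _ (by simp))

/-- a connected component all of whose vertices are star vertices relative to
a maximum matching `M` contains exactly one `M`-unsaturated vertex. -/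
theorem stmt_5 {V : Type} [Fintype V] (G : SimpleGraph V) (M : Set (Sym2 V))
    (hM : IsMatchingSet G M) (hmax : M.ncard = nu G)
    (c : G.ConnectedComponent) (hstar : ∀ v ∈ c.supp, IsStarVertex G M v) :
    ∃! v : V, v ∈ c.supp ∧ ¬ MSaturates M v := by
  obtain ⟨m, hm, hmM, hfix⟩ := hM.exists_isMaxPartner hmax
  have hunsat : ∀ x, ¬ MSaturates M x ↔ m x = x := fun x => by
    rw [← Function.mem_fixedPoints_iff, hfix, Set.mem_ofPred_eq]
  have hmissed : ∀ v ∈ c.supp, ∃ m', IsMaxPartner G m' ∧ m' v = v := fun v hv => by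
    obtain ⟨a, p, hp, ⟨k, hk⟩, ha, halt⟩ := hstar v hv
    refine IsMaxPartner.exists_fixed_end k p hm ((hunsat a).1 ha) hp (by lia) ?_
    intro i hi hlt
    have h := (halt i (by simpa using hlt)).2 hi
    rw [Walk.getElem_edges] at h
    exact hmM _ _ h
  obtain ⟨w, hw⟩ := c.nonempty_supp
  obtain ⟨a, p, -, -, ha, -⟩ := hstar w hw
  have hac : a ∈ c.supp := (ConnectedComponent.sound p.reachable).trans hw
  refine ⟨a, ⟨hac, ha⟩, fun b ⟨hbc, hb⟩ => ?_⟩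
  obtain ⟨q⟩ := ConnectedComponent.exact (hbc.trans hac.symm)
  refine q.notBothMissed (fun x hx => hmissed x ?_) m hm ((hunsat b).1 hb) ((hunsat a).1 ha)
  classical
  exact (ConnectedComponent.sound (q.takeUntil x hx).reachable).symm.trans hbc
end

section
/- For all integers d, m ≥ 2, every finite simple graph G with maximum degree Δ(G) < d and matching number ν(G) < m satisfies |E(G)| ≤ (d-1)(m-1) + ⌊(m-1)/⌈(d-1)/2⌉⌋ · ⌊(d-1)/2⌋. -/
open SimpleGraph

theorem ncard_edgeSet_induce_iUnion_le {V ι : Type*} [Finite V] [Fintype ι] (G : SimpleGraph V)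
    (s : ι → Set V) (h : ∀ u v, G.Adj u v → ∃ i, u ∈ s i ∧ v ∈ s i) :
    G.edgeSet.ncard ≤ ∑ i, (G.induce (s i)).edgeSet.ncard := by
  classical
  cases nonempty_fintype V
  calc G.edgeSet.ncard
      ≤ (⋃ i, Sym2.map Subtype.val '' (G.induce (s i)).edgeSet).ncard := by
        refine Set.ncard_le_ncard ?_ (Set.toFinite _)
        intro e he
        induction e with | _ u v =>
        obtain ⟨i, hu, hv⟩ := h u v he
        exact Set.mem_iUnion.mpr ⟨i, s(⟨u, hu⟩, ⟨v, hv⟩), by simpa using he, rfl⟩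
    _ ≤ ∑ i, (Sym2.map Subtype.val '' (G.induce (s i)).edgeSet).ncard :=
        Set.ncard_iUnion_le_of_fintype _
    _ ≤ ∑ i, (G.induce (s i)).edgeSet.ncard :=
        Finset.sum_le_sum fun i _ => Set.ncard_image_le (Set.toFinite _)

/-- The largest number of edges of a graph with maximum degree `D` and matching number `n`. -/
def chvatalHansonBound (D n : ℕ) : ℕ := D * n + n / ((D + 1) / 2) * (D / 2)

theorem chvatalHansonBound_add_le (D a b : ℕ) :
    chvatalHansonBound D a + chvatalHansonBound D b ≤ chvatalHansonBound D (a + b) := by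
  have h := Nat.mul_le_mul_right (D / 2)
    (Nat.div_add_div_le_add_div (x := a) (y := b) (z := (D + 1) / 2))
  simp only [chvatalHansonBound]
  linarith

theorem chvatalHansonBound_mono (D : ℕ) : Monotone (chvatalHansonBound D) := by
  intro a b h
  obtain ⟨c, rfl⟩ := Nat.exists_eq_add_of_le h
  have := chvatalHansonBound_add_le D a c
  lia

theorem sum_chvatalHansonBound_le {ι : Type*} (D : ℕ) (s : Finset ι) (f : ι → ℕ) :
    ∑ i ∈ s, chvatalHansonBound D (f i) ≤ chvatalHansonBound D (∑ i ∈ s, f i) := by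
  classical
  induction s using Finset.induction_on with
  | empty => simp
  | insert i s hi ih =>
    rw [Finset.sum_insert hi, Finset.sum_insert hi]
    exact (Nat.add_le_add_left ih _).trans (chvatalHansonBound_add_le D _ _)

theorem ncard_edgeSet_le_chvatalHansonBound_of_card {V : Type*} [Finite V] (G : SimpleGraph V)
    {D : ℕ} (hD : ∀ v, (G.neighborSet v).ncard ≤ D) :
    G.edgeSet.ncard ≤ chvatalHansonBound D (Nat.card V / 2) := by
  classical
  cases nonempty_fintype V
  have hsum := G.sum_degrees_eq_twice_card_edges
  have hdeg (v : V) : G.degree v ≤ D := by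
    rw [← G.card_neighborSet_eq_degree, ← Nat.card_eq_fintype_card, Nat.card_coe_set_eq]
    exact hD v
  have hle : ∑ v, G.degree v ≤ Fintype.card V * D := by
    simpa using Finset.sum_le_card_nsmul Finset.univ _ D fun v _ => hdeg v
  have hle' : ∑ v, G.degree v ≤ Fintype.card V * (Fintype.card V - 1) := by
    simpa using Finset.sum_le_card_nsmul Finset.univ _ (Fintype.card V - 1) fun v _ =>
      Nat.le_sub_one_of_lt (G.degree_lt_card_verts v)
  rw [Set.ncard_eq_toFinset_card', ← SimpleGraph.edgeFinset, Nat.card_eq_fintype_card]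
  generalize Fintype.card V = n at *
  generalize G.edgeFinset.card = e at *
  rw [hsum] at hle hle'
  unfold chvatalHansonBound
  obtain ⟨k, rfl | rfl⟩ := Nat.even_or_odd' n
  · rw [Nat.mul_div_cancel_left k two_pos]
    nlinarith [Nat.zero_le (k / ((D + 1) / 2) * (D / 2))]
  · rw [show (2 * k + 1) / 2 = k by lia]
    rcases lt_or_ge k ((D + 1) / 2) with hk | hk
    · have : 2 * k + 1 ≤ D := by lia
      simp only [Nat.add_sub_cancel] at hle'
      nlinarith [Nat.zero_le (k / ((D + 1) / 2) * (D / 2)), Nat.mul_le_mul_left k this]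
    · have hle2 : e ≤ D * k + D / 2 := by
        have : 2 * e ≤ 2 * (D * k) + D := by linarith
        lia
      rcases Nat.eq_zero_or_pos D with rfl | hD0
      · simpa using hle2
      · have := Nat.mul_le_mul_right (D / 2) (Nat.div_pos hk (by lia))
        lia

theorem ncard_edgeSet_le_chvatalHansonBound_of_oddComponents {V : Type*} [Finite V]
    (G : SimpleGraph V) {D : ℕ} (hD : ∀ v, (G.neighborSet v).ncard ≤ D) :
    G.edgeSet.ncard ≤ chvatalHansonBound D ((Nat.card V - G.oddComponents.ncard) / 2) := by
  classical
  cases nonempty_fintype V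
  have hcard : ∑ C : G.ConnectedComponent, C.supp.ncard = Nat.card V := by
    rw [← Set.ncard_univ, ← G.iUnion_connectedComponentSupp,
      Set.ncard_iUnion_of_finite (fun _ => Set.toFinite _)
        G.pairwise_disjoint_supp_connectedComponent, finsum_eq_sum_of_fintype]
  have hodd : ∑ C : G.ConnectedComponent, C.supp.ncard % 2 = G.oddComponents.ncard := by
    unfold SimpleGraph.oddComponents
    rw [Set.ncard_eq_toFinset_card', Set.toFinset_ofPred, Finset.card_filter]
    refine Finset.sum_congr rfl fun C _ => ?_
    split_ifs with h
    · exact Nat.odd_iff.mp h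
    · exact Nat.even_iff.mp (Nat.not_odd_iff_even.mp h)
  have hhalf : (Nat.card V - G.oddComponents.ncard) / 2 =
      ∑ C : G.ConnectedComponent, C.supp.ncard / 2 := by
    have : ∑ C : G.ConnectedComponent, C.supp.ncard =
        ∑ C : G.ConnectedComponent, (2 * (C.supp.ncard / 2) + C.supp.ncard % 2) :=
      Finset.sum_congr rfl fun C _ => (Nat.div_add_mod _ 2).symm
    rw [Finset.sum_add_distrib, ← Finset.mul_sum] at this
    lia
  rw [hhalf]
  refine (ncard_edgeSet_induce_iUnion_le G (fun C : G.ConnectedComponent => C.supp) ?_).trans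
    ((Finset.sum_le_sum fun C _ => ?_).trans (sum_chvatalHansonBound_le D _ _))
  · exact fun u v h => ⟨G.connectedComponentMk u, rfl,
      (SimpleGraph.ConnectedComponent.sound h.reachable).symm⟩
  · refine ncard_edgeSet_le_chvatalHansonBound_of_card _ fun v => (le_trans ?_ (hD v))
    exact Set.ncard_le_ncard_of_injOn Subtype.val (fun w hw => by simpa using hw)
      Subtype.val_injective.injOn (Set.toFinite _)

theorem ncard_oddComponents_eq_of_iso {V W : Type*} {G : SimpleGraph V} {H : SimpleGraph W}
    (φ : G ≃g H) : G.oddComponents.ncard = H.oddComponents.ncard := by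
  rw [← Set.ncard_image_of_injective G.oddComponents φ.connectedComponentEquiv.injective]
  congr 1
  ext C
  obtain ⟨C, rfl⟩ := φ.connectedComponentEquiv.surjective C
  rw [φ.connectedComponentEquiv.injective.mem_set_image]
  simp only [SimpleGraph.oddComponents, Set.mem_ofPred_eq]
  rw [← Nat.card_coe_set_eq, ← Nat.card_coe_set_eq,
    Nat.card_congr (SimpleGraph.ConnectedComponent.isoEquivSupp φ C)]

/-- The join of `G` with a complete graph on `k` new vertices. -/
def joinComplete {V : Type*} (G : SimpleGraph V) (k : ℕ) : SimpleGraph (V ⊕ Fin k) :=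
  (Gᶜ ⊕g (⊥ : SimpleGraph (Fin k)))ᶜ

theorem joinComplete_adj_inl {V : Type*} {G : SimpleGraph V} {k : ℕ} {u v : V} :
    (joinComplete G k).Adj (.inl u) (.inl v) ↔ G.Adj u v := by
  have := @SimpleGraph.Adj.ne V G u v
  simp only [joinComplete, SimpleGraph.compl_adj, SimpleGraph.sum_adj_inl]
  grind

theorem joinComplete_adj_inr {V : Type*} {G : SimpleGraph V} {k : ℕ} {x : V ⊕ Fin k} {i : Fin k}
    (h : x ≠ .inr i) : (joinComplete G k).Adj x (.inr i) := by
  cases x <;> simp_all [joinComplete]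

theorem exists_isMatchingSet_of_isPerfectMatching_joinComplete {V : Type} [Finite V]
    {G : SimpleGraph V} {k : ℕ} {P : (joinComplete G k).Subgraph} (hP : P.IsPerfectMatching) :
    ∃ M, IsMatchingSet G M ∧ Nat.card V ≤ 2 * M.ncard + k := by
  classical
  cases nonempty_fintype V
  rw [SimpleGraph.Subgraph.isPerfectMatching_iff] at hP
  let M : Set (Sym2 V) := {e | e.map Sum.inl ∈ P.edgeSet}
  have hM : M ⊆ G.edgeSet := by
    intro e he
    induction e with | _ u v => exact joinComplete_adj_inl.mp (P.adj_sub he)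
  refine ⟨M, ⟨hM, ?_⟩, ?_⟩
  · intro e he f hf hef v hve hvf
    obtain ⟨a, rfl⟩ := hve
    obtain ⟨b, rfl⟩ := hvf
    have := Sum.inl_injective ((hP (.inl v)).unique he hf)
    exact hef (by rw [this])
  · choose p hp hpu using hP
    let A : Finset V := M.toFinset.biUnion Sym2.toFinset
    let B : Finset V := {v | ∃ i, p (.inl v) = .inr i}
    have hA : A.card ≤ M.toFinset.card * 2 := by
      refine Finset.card_biUnion_le_card_mul _ _ _ fun e he => ?_
      rw [Sym2.card_toFinset]
      split_ifs <;> simp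
    have hB : B.card ≤ k := by
      rw [← Fintype.card_fin k, ← Finset.card_univ,
        ← Finset.card_image_of_injective (β := V ⊕ Fin k) Finset.univ Sum.inr_injective]
      refine Finset.card_le_card_of_injOn (fun v => p (.inl v)) ?_ ?_
      · intro v hv
        obtain ⟨i, hi⟩ := (Finset.mem_filter.mp hv).2
        simp [hi]
      · intro u _ v _ huv
        have h1 := hpu _ _ (hp (.inl u)).symm
        have h2 := hpu _ _ (hp (.inl v)).symm
        exact Sum.inl_injective (h1.trans ((congrArg p huv).trans h2.symm))
    have hAB : (Finset.univ : Finset V) ⊆ A ∪ B := by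
      intro v _
      rw [Finset.mem_union]
      rcases h : p (.inl v) with w | i
      · left
        refine Finset.mem_biUnion.mpr ⟨s(v, w), ?_, by simp⟩
        have := hp (.inl v)
        rw [h] at this
        simpa [M] using this
      · exact .inr (by simp [B, h])
    have := (Finset.card_le_card hAB).trans (Finset.card_union_le A B)
    rw [Nat.card_eq_fintype_card, ← Finset.card_univ, Set.ncard_eq_toFinset_card']
    lia

/-- The nontrivial direction of the **Tutte–Berge formula**. -/
theorem exists_ncard_add_le_of_forall_isMatchingSet {V : Type} [Finite V] (G : SimpleGraph V)
    {n : ℕ} (hn : ∀ M, IsMatchingSet G M → M.ncard ≤ n) :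
    ∃ S : Set V, S.ncard + (Nat.card ↥Sᶜ - (G.induce Sᶜ).oddComponents.ncard) / 2 ≤ n := by
  classical
  cases nonempty_fintype V
  rcases le_or_gt (Nat.card V) (2 * n + 1) with hV | hV
  · refine ⟨∅, ?_⟩
    have : Nat.card ↥(∅ : Set V)ᶜ ≤ Nat.card V := Finite.card_subtype_le _
    rw [Set.ncard_empty]
    lia
  obtain ⟨k, hk⟩ : ∃ k, Nat.card V = 2 * n + 2 + k := Nat.exists_eq_add_of_le hV
  obtain ⟨u, hu⟩ : ∃ u, (joinComplete G k).IsTutteViolator u := by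
    by_contra! h
    obtain ⟨P, hP⟩ := SimpleGraph.tutte.mpr h
    obtain ⟨M, hM, hle⟩ := exists_isMatchingSet_of_isPerfectMatching_joinComplete hP
    have := hn M hM
    lia
  unfold SimpleGraph.IsTutteViolator at hu
  set H := ((⊤ : (joinComplete G k).Subgraph).deleteVerts u).coe with hH
  have hparity := H.odd_ncard_oddComponents
  have hcardH : Nat.card ↥((⊤ : (joinComplete G k).Subgraph).deleteVerts u).verts + u.ncard
      = Nat.card V + k := by
    rw [SimpleGraph.Subgraph.deleteVerts_verts, SimpleGraph.Subgraph.verts_top,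
      ← Set.compl_eq_univ_sdiff, Nat.card_coe_set_eq, Set.ncard_compl_add_ncard, Nat.card_sum,
      Nat.card_fin]
  by_cases hr : Set.range Sum.inr ⊆ u
  · have hmem : ∀ x ∉ u, ∃ v, Sum.inl v = x := by
      rintro (v | i) hx
      · exact ⟨v, rfl⟩
      · exact (hx (hr ⟨i, rfl⟩)).elim
    have hin (v : ↥(Sum.inl ⁻¹' u : Set V)ᶜ) :
        Sum.inl v.1 ∈ ((⊤ : (joinComplete G k).Subgraph).deleteVerts u).verts :=
      ⟨trivial, v.2⟩
    let φ : G.induce (Sum.inl ⁻¹' u)ᶜ ≃g H :=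
      { toEquiv := Equiv.ofBijective (fun v => ⟨.inl v.1, hin v⟩) (by
          constructor
          · intro v w h
            exact Subtype.ext (Sum.inl_injective (congrArg Subtype.val h))
          · rintro ⟨x, hx⟩
            obtain ⟨v, rfl⟩ := hmem x (by simpa using hx)
            exact ⟨⟨v, by simpa using hx⟩, rfl⟩)
        map_rel_iff' := by
          rintro ⟨v, hv⟩ ⟨w, hw⟩
          have hv' : Sum.inl v ∉ u := hv
          have hw' : Sum.inl w ∉ u := hw
          change H.Adj ⟨.inl v, hin ⟨v, hv⟩⟩ ⟨.inl w, hin ⟨w, hw⟩⟩ ↔ G.Adj v w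
          simp [hH, hv', hw', joinComplete_adj_inl] }
    refine ⟨Sum.inl ⁻¹' u, ?_⟩
    rw [ncard_oddComponents_eq_of_iso φ, Nat.card_congr φ.toEquiv]
    have hcard : u.ncard = (Sum.inl ⁻¹' u : Set V).ncard + k := by
      have h1 : u = Sum.inl '' (Sum.inl ⁻¹' u : Set V) ∪ Set.range Sum.inr := by
        ext (v | i)
        · simp
        · simpa using hr ⟨i, rfl⟩
      have h2 : Disjoint (Sum.inl '' (Sum.inl ⁻¹' u : Set V))
          (Set.range (Sum.inr : Fin k → V ⊕ Fin k)) := by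
        rw [Set.disjoint_left]
        rintro _ ⟨v, _, rfl⟩ ⟨i, hi⟩
        cases hi
      conv_lhs => rw [h1]
      rw [Set.ncard_union_eq h2, Set.ncard_image_of_injective _ Sum.inl_injective,
        ← Set.image_univ, Set.ncard_image_of_injective _ Sum.inr_injective, Set.ncard_univ,
        Nat.card_fin]
    have hle : H.oddComponents.ncard ≤
        Nat.card ↥((⊤ : (joinComplete G k).Subgraph).deleteVerts u).verts :=
      (Set.ncard_le_card _).trans
        (Nat.card_le_card_of_surjective H.connectedComponentMk Quot.mk_surjective)
    lia
  · exfalso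
    obtain ⟨_, ⟨i, rfl⟩, hi⟩ := Set.not_subset.mp hr
    let c : ((⊤ : (joinComplete G k).Subgraph).deleteVerts u).verts := ⟨.inr i, by simpa using hi⟩
    have hreach (x) : H.connectedComponentMk x = H.connectedComponentMk c := by
      by_cases hx : x = c
      · rw [hx]
      · refine SimpleGraph.ConnectedComponent.sound (SimpleGraph.Adj.reachable ?_)
        have hxu : (x : V ⊕ Fin k) ∉ u := by simpa using x.2
        have := joinComplete_adj_inr (G := G) (x := x.1) (i := i) fun h => hx (Subtype.ext h)
        simpa [hH, c, hi, hxu] using this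
    have hsub : H.oddComponents ⊆ {H.connectedComponentMk c} := by
      rintro C -
      induction C using SimpleGraph.ConnectedComponent.ind with | _ x => exact hreach x
    have := Set.ncard_le_ncard hsub
    rw [Set.ncard_singleton] at this
    have h1 : H.oddComponents.ncard = 1 := by lia
    rw [h1] at hparity
    have := Nat.odd_iff.mp (hparity.mp odd_one)
    lia

theorem ncard_edgeSet_le_of_forall_isMatchingSet {V : Type} [Finite V] (G : SimpleGraph V)
    {D n : ℕ} (hD : ∀ v, (G.neighborSet v).ncard ≤ D)
    (hn : ∀ M, IsMatchingSet G M → M.ncard ≤ n) :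
    G.edgeSet.ncard ≤ chvatalHansonBound D n := by
  classical
  cases nonempty_fintype V
  obtain ⟨S, hS⟩ := exists_ncard_add_le_of_forall_isMatchingSet G hn
  set h := (Nat.card ↥Sᶜ - (G.induce Sᶜ).oddComponents.ncard) / 2
  have hinc : (⋃ s ∈ S.toFinset, G.incidenceSet s).ncard ≤ D * S.ncard := by
    refine (Finset.set_ncard_biUnion_le _ _).trans ?_
    rw [Set.ncard_eq_toFinset_card', mul_comm, ← smul_eq_mul]
    refine Finset.sum_le_card_nsmul _ _ _ fun v _ => ?_
    rw [Set.ncard_congr' (G.incidenceSetEquivNeighborSet v)]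
    exact hD v
  have hind : (G.induce Sᶜ).edgeSet.ncard ≤ chvatalHansonBound D h := by
    refine ncard_edgeSet_le_chvatalHansonBound_of_oddComponents _ fun v => (le_trans ?_ (hD v))
    exact Set.ncard_le_ncard_of_injOn Subtype.val (fun w hw => by simpa using hw)
      Subtype.val_injective.injOn (Set.toFinite _)
  have hcover : G.edgeSet ⊆
      (⋃ s ∈ S.toFinset, G.incidenceSet s) ∪ Sym2.map Subtype.val '' (G.induce Sᶜ).edgeSet := by
    intro e he
    by_cases hex : ∃ s ∈ S, s ∈ e
    · obtain ⟨s, hs, hse⟩ := hex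
      exact .inl (Set.mem_biUnion (Set.mem_toFinset.mpr hs) ⟨he, hse⟩)
    · push Not at hex
      induction e with | _ u v =>
      exact .inr ⟨s(⟨u, fun hu => hex u hu (Sym2.mem_mk_left u v)⟩,
        ⟨v, fun hv => hex v hv (Sym2.mem_mk_right u v)⟩), by simpa using he, rfl⟩
  calc G.edgeSet.ncard
      ≤ D * S.ncard + chvatalHansonBound D h :=
        (Set.ncard_le_ncard hcover (Set.toFinite _)).trans <| (Set.ncard_union_le _ _).trans <|
          add_le_add hinc ((Set.ncard_image_le (Set.toFinite _)).trans hind)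
    _ ≤ chvatalHansonBound D S.ncard + chvatalHansonBound D h :=
        Nat.add_le_add_right (Nat.le_add_right _ _) _
    _ ≤ chvatalHansonBound D (S.ncard + h) := chvatalHansonBound_add_le D _ _
    _ ≤ chvatalHansonBound D n := chvatalHansonBound_mono D hS

/-- if `Δ(G) < d` and `ν(G) < m` then
`|E(G)| ≤ (d-1)(m-1) + ⌊(m-1)/⌈(d-1)/2⌉⌋·⌊(d-1)/2⌋`. -/
theorem stmt_10 {d m : ℕ} (hd : 2 ≤ d) (hm : 2 ≤ m) {V : Type} [Fintype V]
    (G : SimpleGraph V) (hΔ : ∀ v : V, (G.neighborSet v).ncard < d) (hν : nu G < m) :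
    G.edgeSet.ncard ≤
      (d - 1) * (m - 1) + (m - 1) / (((d - 1) + 1) / 2) * ((d - 1) / 2) := by
  refine ncard_edgeSet_le_of_forall_isMatchingSet G (fun v => Nat.le_sub_one_of_lt (hΔ v))
    fun M hM => Nat.le_sub_one_of_lt (lt_of_le_of_lt ?_ hν)
  refine le_csSup ?_ ⟨M, hM, rfl⟩
  refine ⟨G.edgeSet.ncard, ?_⟩
  rintro _ ⟨M, hM, rfl⟩
  exact Set.ncard_le_ncard hM.1 (Set.toFinite _)
end
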